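/- Let C₁ = {(x,y) ∈ ℂ² : y = x⁴}, C₂ = {(x,y) ∈ ℂ² : y = x² + x⁴}, C₃ = {(x,y) ∈ ℂ² : y = x³ + x⁴}, and set C = C₁ ∪ C₂ and C̃ = C₁ ∪ C₃. Then C and C̃ are blow-spherical homeomorphic, but C and C̃ are not outer lipeomorphic (there is no bi-Lipschitz bijection C → C̃ with respect to the Euclidean distances). -/

import Mathlib

open Filter Set Topology

noncomputable section

section TopDefs

variable {α β : Type*} [TopologicalSpace α] [TopologicalSpace β]

/-- `h` restricts to a homeomorphism from `X` onto `Y` (for the subspace topologies). -/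
def IsHomeoOn (h : α → β) (X : Set α) (Y : Set β) : Prop :=
  Set.BijOn h X Y ∧ ContinuousOn h X ∧
    ∃ g : β → α, (∀ x ∈ X, g (h x) = x) ∧ (∀ y ∈ Y, h (g y) = y) ∧ ContinuousOn g Y

/-- `A` is a topological manifold of dimension `d` (charts onto open subsets of `ℝ^d`). -/
def IsTopManifoldOfDim (A : Set α) (d : ℕ) : Prop :=
  ∀ a ∈ A, ∃ W : Set α, IsOpen W ∧ a ∈ W ∧
    ∃ (U : Set (EuclideanSpace ℝ (Fin d))) (f : α → EuclideanSpace ℝ (Fin d)),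
      IsOpen U ∧ IsHomeoOn f (A ∩ W) U

/-- The model half-space in `ℝ^d`. -/
def halfSpace (d : ℕ) : Set (EuclideanSpace ℝ (Fin d)) :=
  {u | ∀ hd : 0 < d, 0 ≤ u ⟨0, hd⟩}

/-- `A` is a topological manifold with boundary of dimension `d`
(charts onto relatively open subsets of the half-space of `ℝ^d`). -/
def IsTopManifoldWithBoundaryOfDim (A : Set α) (d : ℕ) : Prop :=
  ∀ a ∈ A, ∃ W : Set α, IsOpen W ∧ a ∈ W ∧
    ∃ (V : Set (EuclideanSpace ℝ (Fin d))) (f : α → EuclideanSpace ℝ (Fin d)),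
      IsOpen V ∧ IsHomeoOn f (A ∩ W) (V ∩ halfSpace d)

end TopDefs

section BlowSpherical

variable {E F : Type*} [NormedAddCommGroup E] [NormedSpace ℝ E]
  [NormedAddCommGroup F] [NormedSpace ℝ F]

/-- The inverse of the spherical blow-up at `p`, `x ↦ ((x-p)/‖x-p‖, ‖x-p‖)`. -/
def blowupInv (p x : E) : E × ℝ := (‖x - p‖⁻¹ • (x - p), ‖x - p‖)

/-- The inverse of the spherical blow-up at infinity, `x ↦ (x/‖x‖, 1/‖x‖)`. -/
def blowupInvInf (x : E) : E × ℝ := (‖x‖⁻¹ • x, ‖x‖⁻¹)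

/-- The strict transform of `X` under the spherical blow-up at `p`. -/
def strictTransform (X : Set E) (p : E) : Set (E × ℝ) := closure (blowupInv p '' (X \ {p}))

/-- The strict transform of `X` under the spherical blow-up at infinity. -/
def strictTransformInf (X : Set E) : Set (E × ℝ) := closure (blowupInvInf '' (X \ {0}))

/-- The strict transform at `p ∈ E ∪ {∞}`, where `none` stands for `∞`. -/
def strictTransformO (X : Set E) : Option E → Set (E × ℝ)
  | some p => strictTransform X p
  | none => strictTransformInf X

/-- The boundary of a strict transform: the points with second coordinate `0`. -/
def transformBoundary (T : Set (E × ℝ)) : Set (E × ℝ) := {z ∈ T | z.2 = 0}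

/-- The filter of neighbourhoods of infinity within `X`. -/
def atInftyOn (X : Set E) : Filter E :=
  Filter.comap (fun x : E => ‖x‖) Filter.atTop ⊓ Filter.principal X

/-- `q = lim_{x → p} h(x)` where `p ∈ E ∪ {∞}`, `q ∈ F ∪ {∞}` (`none` stands for `∞`). -/
def BSLimit (h : E → F) (X : Set E) : Option E → Option F → Prop
  | some p, some q => Filter.Tendsto h (nhdsWithin p X) (nhds q)
  | some p, none => Filter.Tendsto (fun x => ‖h x‖) (nhdsWithin p X) Filter.atTop
  | none, some q => Filter.Tendsto h (atInftyOn X) (nhds q)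
  | none, none => Filter.Tendsto (fun x => ‖h x‖) (atInftyOn X) Filter.atTop

/-- The inverse of the spherical blow-up at `p ∈ E ∪ {∞}`. -/
def blowupInvO : Option E → E → E × ℝ
  | some p, x => blowupInv p x
  | none, x => blowupInvInf x

/-- `x` is the center of the spherical blow-up at `p ∈ E ∪ {∞}` (at infinity, the center is `0`). -/
def IsCenter : Option E → E → Prop
  | some p, x => x = p
  | none, x => x = 0

/-- `h` is a blow-spherical homeomorphism from `X` onto `Y` at `p ∈ E ∪ {∞}` (with
`q = lim_{x → p} h(x) ∈ F ∪ {∞}`): `h` is a homeomorphism from `X` onto `Y` and the induced map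
between the strict transforms extends to a homeomorphism `Φ` of the strict transforms. -/
def IsBSHomeoAtO (h : E → F) (X : Set E) (Y : Set F) (po : Option E) (qo : Option F) : Prop :=
  IsHomeoOn h X Y ∧ BSLimit h X po qo ∧
    ∃ Φ : E × ℝ → F × ℝ,
      IsHomeoOn Φ (strictTransformO X po) (strictTransformO Y qo) ∧
      ∀ x ∈ X, ¬ IsCenter po x → ¬ IsCenter qo (h x) →
        Φ (blowupInvO po x) = blowupInvO qo (h x)

/-- `h` is a (global) blow-spherical homeomorphism from `X` onto `Y`: it is a blow-spherical
homeomorphism at every `p ∈ closure X ∪ {∞}`. -/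
def IsBSHomeo (h : E → F) (X : Set E) (Y : Set F) : Prop :=
  IsHomeoOn h X Y ∧
    (∀ p ∈ closure X, ∃ qo : Option F, IsBSHomeoAtO h X Y (some p) qo) ∧
    (∃ qo : Option F, IsBSHomeoAtO h X Y none qo)

/-- `X` and `Y` are blow-spherical homeomorphic at infinity: outside suitable compact sets there
is a homeomorphism which is blow-spherical at `∞`. -/
def BSHomeoAtInfinity (X : Set E) (Y : Set F) : Prop :=
  ∃ (K : Set E) (K' : Set F), IsCompact K ∧ IsCompact K' ∧
    ∃ h : E → F, IsBSHomeoAtO h (X \ K) (Y \ K') none none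

/-- The tangent cone of `X` at `p`. -/
def tangConeAt (X : Set E) (p : E) : Set E :=
  {v | ∃ (x : ℕ → E) (t : ℕ → ℝ), (∀ i, x i ∈ X) ∧ (∀ i, 0 < t i) ∧
    Filter.Tendsto x Filter.atTop (nhds p) ∧
    Filter.Tendsto (fun i => (t i)⁻¹ • (x i - p)) Filter.atTop (nhds v)}

/-- The tangent cone of `X` at infinity. -/
def tangConeInf (X : Set E) : Set E :=
  {v | ∃ (x : ℕ → E) (t : ℕ → ℝ), (∀ i, x i ∈ X) ∧ (∀ i, 0 < t i) ∧
    Filter.Tendsto (fun i => ‖x i‖) Filter.atTop Filter.atTop ∧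
    Filter.Tendsto (fun i => (t i)⁻¹ • x i) Filter.atTop (nhds v)}

/-- The tangent cone of `X` at `p ∈ E ∪ {∞}`. -/
def tangConeO (X : Set E) : Option E → Set E
  | some p => tangConeAt X p
  | none => tangConeInf X

/-- `Cone_∞(A) = {t • a : a ∈ A, t ≥ 1}`. -/
def coneInfSet (A : Set E) : Set E := {y | ∃ a ∈ A, ∃ t : ℝ, 1 ≤ t ∧ y = t • a}

/-- The inner distance on `X`: the infimum of lengths of paths in `X` joining `x` to `y`. -/
def innerDist (X : Set E) (x y : E) : ENNReal :=
  ⨅ (γ : ℝ → E) (_ : ContinuousOn γ (Set.Icc 0 1)) (_ : Set.MapsTo γ (Set.Icc 0 1) X)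
    (_ : γ 0 = x) (_ : γ 1 = y), eVariationOn γ (Set.Icc 0 1)

/-- `X` is Lipschitz normally embedded. -/
def IsLNE (X : Set E) : Prop :=
  ∃ c : ℝ, 1 ≤ c ∧ ∀ x ∈ X, ∀ y ∈ X, innerDist X x y ≤ ENNReal.ofReal (c * ‖x - y‖)

/-- `X` is Lipschitz normally embedded at the point `p`. -/
def IsLNEAt (X : Set E) (p : E) : Prop := ∃ U : Set E, IsOpen U ∧ p ∈ U ∧ IsLNE (X ∩ U)

/-- `X` is Lipschitz normally embedded at infinity. -/
def IsLNEAtInf (X : Set E) : Prop := ∃ K : Set E, IsCompact K ∧ IsLNE (X \ K)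

/-- `X` and `Y` are outer lipeomorphic. -/
def OuterLipeo (X : Set E) (Y : Set F) : Prop :=
  ∃ (h : E → F) (lam : ℝ), 1 ≤ lam ∧ Set.BijOn h X Y ∧
    ∀ x ∈ X, ∀ x' ∈ X, lam⁻¹ * ‖x - x'‖ ≤ ‖h x - h x'‖ ∧ ‖h x - h x'‖ ≤ lam * ‖x - x'‖

/-- `X` and `Y` are outer lipeomorphic at infinity. -/
def OuterLipeoAtInf (X : Set E) (Y : Set F) : Prop :=
  ∃ (K : Set E) (K' : Set F), IsCompact K ∧ IsCompact K' ∧ OuterLipeo (X \ K) (Y \ K')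

/-- The ends of `C` relative to `R`: the connected components of `C \ {‖x‖ ≤ R}`. -/
def endsRel (C : Set E) (R : ℝ) : Set (Set E) :=
  {A | ∃ x ∈ C \ Metric.closedBall 0 R, A = connectedComponentIn (C \ Metric.closedBall 0 R) x}

/-- `X` contains a homeomorphic copy of a nonempty open subset of `ℝ^d`. -/
def HasDimGE (X : Set E) (d : ℕ) : Prop :=
  ∃ (U : Set (EuclideanSpace ℝ (Fin d))) (f : EuclideanSpace ℝ (Fin d) → E),
    IsOpen U ∧ U.Nonempty ∧ f '' U ⊆ X ∧ IsHomeoOn f U (f '' U)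

/-- `X` has (topological) dimension `d`. -/
def HasDim (X : Set E) (d : ℕ) : Prop := HasDimGE X d ∧ ¬ HasDimGE X (d + 1)

/-- `x` is a simple point of the boundary of the strict transform `T`, relative to dimension `d`:
near `x`, the connected components of `T` minus the boundary are `d`-dimensional topological
manifolds, and together with the boundary they are topological manifolds with boundary. -/
def IsSimplePointOf (T : Set (E × ℝ)) (d : ℕ) (x : E × ℝ) : Prop :=
  x ∈ transformBoundary T ∧
    ∃ W : Set (E × ℝ), IsOpen W ∧ x ∈ W ∧
      ∀ y ∈ (T ∩ W) \ transformBoundary T,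
        IsTopManifoldOfDim (connectedComponentIn ((T ∩ W) \ transformBoundary T) y) d ∧
        IsTopManifoldWithBoundaryOfDim
          (connectedComponentIn ((T ∩ W) \ transformBoundary T) y ∪ (transformBoundary T ∩ W)) d

/-- `x` is a simple point of the boundary of the strict transform `T` of the set `X`. -/
def IsSimplePoint (X : Set E) (T : Set (E × ℝ)) (x : E × ℝ) : Prop :=
  ∃ d : ℕ, HasDim X d ∧ IsSimplePointOf T d x

/-- The relative multiplicity: for every sufficiently small open neighbourhood `W` of `x`,
the number of connected components of `(T \ ∂T) ∩ W` whose closure contains `x` equals `k`. -/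
def RelMultAt (T : Set (E × ℝ)) (x : E × ℝ) (k : ℕ) : Prop :=
  ∃ W₀ : Set (E × ℝ), IsOpen W₀ ∧ x ∈ W₀ ∧
    ∀ W : Set (E × ℝ), IsOpen W → x ∈ W → W ⊆ W₀ →
      {C : Set (E × ℝ) |
        (∃ y ∈ (T \ transformBoundary T) ∩ W,
          C = connectedComponentIn ((T \ transformBoundary T) ∩ W) y) ∧
        x ∈ closure C}.ncard = k

/-- The relative multiplicity of the end `A` (at infinity) equals `k`: the relative multiplicity
equals `k` on a dense open subset of the boundary of the strict transform at infinity of `A`. -/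
def EndMult (A : Set E) (k : ℕ) : Prop :=
  ∃ U : Set (E × ℝ), IsOpen U ∧
    transformBoundary (strictTransformInf A) ⊆
      closure (transformBoundary (strictTransformInf A) ∩ U) ∧
    ∀ x ∈ transformBoundary (strictTransformInf A) ∩ U, RelMultAt (strictTransformInf A) x k

end BlowSpherical

section Algebraic

/-- `X ⊆ ℝ^n` is semialgebraic. -/
def IsSemialgebraic {n : ℕ} (X : Set (EuclideanSpace ℝ (Fin n))) : Prop :=
  ∃ (m : ℕ) (P : Fin m → MvPolynomial (Fin n) ℝ) (k : Fin m → ℕ)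
    (Q : (i : Fin m) → Fin (k i) → MvPolynomial (Fin n) ℝ),
    X = ⋃ i, {x | MvPolynomial.eval (fun j => x j) (P i) = 0 ∧
      ∀ l, 0 < MvPolynomial.eval (fun j => x j) (Q i l)}

/-- The map `h` is semialgebraic on `X`: its graph over `X` is a semialgebraic set. -/
def IsSemialgebraicMapOn {n m : ℕ} (h : EuclideanSpace ℝ (Fin n) → EuclideanSpace ℝ (Fin m))
    (X : Set (EuclideanSpace ℝ (Fin n))) : Prop :=
  IsSemialgebraic { z : EuclideanSpace ℝ (Fin (n + m)) |
    ∃ x ∈ X, (∀ i : Fin n, z (Fin.castAdd m i) = x i) ∧ ∀ j : Fin m, z (Fin.natAdd n j) = h x j }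

/-- `γ` is a continuous semialgebraic arc on `(ε, ∞)`. -/
def IsSemialgebraicArc {n : ℕ} (γ : ℝ → EuclideanSpace ℝ (Fin n)) (ε : ℝ) : Prop :=
  ContinuousOn γ (Set.Ioi ε) ∧
  IsSemialgebraic { z : EuclideanSpace ℝ (Fin (1 + n)) |
    ∃ t ∈ Set.Ioi ε, z (Fin.castAdd n 0) = t ∧ ∀ j : Fin n, z (Fin.natAdd 1 j) = γ t j }

/-- `X ⊆ ℂ^n` is a complex algebraic set. -/
def IsComplexAlgebraic {n : ℕ} (X : Set (EuclideanSpace ℂ (Fin n))) : Prop :=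
  ∃ (m : ℕ) (P : Fin m → MvPolynomial (Fin n) ℂ),
    X = {x | ∀ i, MvPolynomial.eval (fun j => x j) (P i) = 0}

/-- `X` is an irreducible complex algebraic set. -/
def IsIrreducibleAlg {n : ℕ} (X : Set (EuclideanSpace ℂ (Fin n))) : Prop :=
  X.Nonempty ∧ IsComplexAlgebraic X ∧
    ∀ A B : Set (EuclideanSpace ℂ (Fin n)),
      IsComplexAlgebraic A → IsComplexAlgebraic B → X = A ∪ B → X = A ∨ X = B

/-- `C` is an irreducible component of `X`: a maximal irreducible algebraic subset of `X`. -/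
def IsIrredComponent {n : ℕ} (C X : Set (EuclideanSpace ℂ (Fin n))) : Prop :=
  IsIrreducibleAlg C ∧ C ⊆ X ∧
    ∀ C' : Set (EuclideanSpace ℂ (Fin n)), IsIrreducibleAlg C' → C' ⊆ X → C ⊆ C' → C = C'

/-- The (Krull) dimension of the algebraic set `C` equals `d`: there is a strictly increasing
chain of `d+1` irreducible algebraic sets ending in `C`, and no such chain of `d+2` sets. -/
def HasAlgDim {n : ℕ} (C : Set (EuclideanSpace ℂ (Fin n))) (d : ℕ) : Prop :=
  (∃ f : Fin (d + 1) → Set (EuclideanSpace ℂ (Fin n)),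
    (∀ i, IsIrreducibleAlg (f i)) ∧ StrictMono f ∧ f (Fin.last d) = C) ∧
  ¬ ∃ f : Fin (d + 2) → Set (EuclideanSpace ℂ (Fin n)),
    (∀ i, IsIrreducibleAlg (f i)) ∧ StrictMono f ∧ f (Fin.last (d + 1)) = C

/-- `X ⊆ ℂ^n` is a complex algebraic curve: a nonempty complex algebraic set all of whose
irreducible components have complex dimension 1. -/
def IsComplexAlgebraicCurve {n : ℕ} (X : Set (EuclideanSpace ℂ (Fin n))) : Prop :=
  IsComplexAlgebraic X ∧ X.Nonempty ∧ ∀ C, IsIrredComponent C X → HasAlgDim C 1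

/-- `X ⊆ ℂ^n` is a pure dimensional complex algebraic set. -/
def IsPureDimComplexAlgebraic {n : ℕ} (X : Set (EuclideanSpace ℂ (Fin n))) : Prop :=
  IsComplexAlgebraic X ∧ X.Nonempty ∧ ∃ d, ∀ C, IsIrredComponent C X → HasAlgDim C d

/-- `S` is a 1-dimensional complex submanifold: locally the image of a holomorphic embedding,
with nowhere-vanishing derivative, of an open subset of `ℂ`. -/
def IsOneDimComplexSubmanifold {n : ℕ} (S : Set (EuclideanSpace ℂ (Fin n))) : Prop :=
  ∀ z ∈ S, ∃ (W : Set (EuclideanSpace ℂ (Fin n))) (V : Set ℂ)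
    (f : ℂ → EuclideanSpace ℂ (Fin n)),
    IsOpen W ∧ z ∈ W ∧ IsOpen V ∧ DifferentiableOn ℂ f V ∧ Set.InjOn f V ∧
    (∀ t ∈ V, derivWithin f V t ≠ 0) ∧ f '' V = S ∩ W

/-- The set of singular points of `X ⊆ ℂ^n`. -/
def SingSet {n : ℕ} (X : Set (EuclideanSpace ℂ (Fin n))) : Set (EuclideanSpace ℂ (Fin n)) :=
  {p ∈ X | ¬ ∃ U : Set (EuclideanSpace ℂ (Fin n)), IsOpen U ∧ p ∈ U ∧
    IsOneDimComplexSubmanifold (X ∩ U)}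

/-- The embedding `ι : ℂ^n → ℙ^n(ℂ)`, `x ↦ [1 : x]`. -/
def projIota {n : ℕ} (x : EuclideanSpace ℂ (Fin n)) : Projectivization ℂ (Fin (n + 1) → ℂ) :=
  Projectivization.mk ℂ (Fin.cons 1 (fun j => x j)) (by
    intro hzero
    have h0 := congrFun hzero 0
    simp at h0)

end Algebraic

section Extension

theorem extendFrom_eqOn {α β : Type*} [TopologicalSpace α] [TopologicalSpace β] [T2Space β]
    {A : Set α} {f : α → β} (hfl : ∀ z ∈ closure A, ∃ y, Tendsto f (𝓝[A] z) (𝓝 y)) :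
    EqOn (extendFrom A f) f A := by
  intro a ha
  obtain ⟨y, hy⟩ := hfl a (subset_closure ha)
  have hya : f a = y :=
    tendsto_nhds_unique (tendsto_pure_nhds f a) (hy.mono_left (pure_le_nhdsWithin ha))
  exact extendFrom_eq (subset_closure ha) (hya ▸ hy)

/-- Mutually inverse maps between subsets that have limits at all points of the closures
extend to a homeomorphism of the closures. -/
theorem exists_isHomeoOn_closure {α β : Type*} [TopologicalSpace α] [TopologicalSpace β]
    [T3Space α] [T3Space β] {A : Set α} {B : Set β} {f : α → β} {g : β → α}
    (hf : MapsTo f A B) (hg : MapsTo g B A) (hgf : LeftInvOn g f A) (hfg : LeftInvOn f g B)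
    (hfl : ∀ z ∈ closure A, ∃ y, Tendsto f (𝓝[A] z) (𝓝 y))
    (hgl : ∀ z ∈ closure B, ∃ y, Tendsto g (𝓝[B] z) (𝓝 y)) :
    ∃ Φ : α → β, IsHomeoOn Φ (closure A) (closure B) ∧ EqOn Φ f A := by
  have hΦ : ContinuousOn (extendFrom A f) (closure A) := continuousOn_extendFrom subset_rfl hfl
  have hΨ : ContinuousOn (extendFrom B g) (closure B) := continuousOn_extendFrom subset_rfl hgl
  have eΦ : EqOn (extendFrom A f) f A := extendFrom_eqOn hfl
  have eΨ : EqOn (extendFrom B g) g B := extendFrom_eqOn hgl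
  have mΦ : MapsTo (extendFrom A f) (closure A) (closure B) :=
    (hf.congr eΦ.symm).closure_of_continuousOn hΦ
  have mΨ : MapsTo (extendFrom B g) (closure B) (closure A) :=
    (hg.congr eΨ.symm).closure_of_continuousOn hΨ
  have lΦ : LeftInvOn (extendFrom B g) (extendFrom A f) (closure A) := by
    have : EqOn (extendFrom B g ∘ extendFrom A f) id A := fun a ha => by
      simp [eΦ ha, eΨ (hf ha), hgf ha]
    exact this.of_subset_closure (hΨ.comp hΦ mΦ) continuousOn_id subset_closure subset_rfl
  have lΨ : LeftInvOn (extendFrom A f) (extendFrom B g) (closure B) := by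
    have : EqOn (extendFrom A f ∘ extendFrom B g) id B := fun a ha => by
      simp [eΨ ha, eΦ (hg ha), hfg ha]
    exact this.of_subset_closure (hΦ.comp hΨ mΨ) continuousOn_id subset_closure subset_rfl
  exact ⟨extendFrom A f, ⟨InvOn.bijOn ⟨lΦ, lΨ⟩ mΦ mΨ, hΦ, extendFrom B g, lΦ, lΨ, hΨ⟩, eΦ⟩

/-- A bijection between subsets induces a homeomorphism between the closures of their images
under injective maps, provided that the induced maps have limits at all points. -/
theorem exists_isHomeoOn_closure_image {α β γ δ : Type*} [TopologicalSpace γ] [TopologicalSpace δ]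
    [T3Space γ] [T3Space δ] {X : Set α} {Y : Set β} {h : α → β} {g : β → α} {b : α → γ} {c : β → δ}
    {b' : γ → α} {c' : δ → β} (hb : LeftInvOn b' b X) (hc : LeftInvOn c' c Y)
    (hh : MapsTo h X Y) (hg : MapsTo g Y X) (hgh : LeftInvOn g h X) (hhg : LeftInvOn h g Y)
    (hl : ∀ z ∈ closure (b '' X), ∃ y, Tendsto (fun x => c (h x)) (comap b (𝓝 z) ⊓ 𝓟 X) (𝓝 y))
    (hl' : ∀ z ∈ closure (c '' Y), ∃ y, Tendsto (fun x => b (g x)) (comap c (𝓝 z) ⊓ 𝓟 Y) (𝓝 y)) :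
    ∃ Φ : γ → δ, IsHomeoOn Φ (closure (b '' X)) (closure (c '' Y)) ∧
      ∀ x ∈ X, Φ (b x) = c (h x) := by
  obtain ⟨Φ, hΦ, hΦ'⟩ := exists_isHomeoOn_closure (A := b '' X) (B := c '' Y)
    (f := fun z => c (h (b' z))) (g := fun z => b (g (c' z)))
    (by rintro _ ⟨x, hx, rfl⟩; exact ⟨h x, hh hx, by simp [hb hx]⟩)
    (by rintro _ ⟨x, hx, rfl⟩; exact ⟨g x, hg hx, by simp [hc hx]⟩)
    (by rintro _ ⟨x, hx, rfl⟩; simp [hb hx, hc (hh hx), hgh hx])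
    (by rintro _ ⟨x, hx, rfl⟩; simp [hc hx, hb (hg hx), hhg hx])
    (by
      intro z hz
      obtain ⟨y, hy⟩ := hl z hz
      refine ⟨y, ?_⟩
      rw [nhdsWithin, ← map_principal, ← Filter.push_pull', tendsto_map'_iff]
      refine hy.congr' ?_
      filter_upwards [mem_inf_of_right (mem_principal_self X)] with x hx
      simp [hb hx])
    (by
      intro z hz
      obtain ⟨y, hy⟩ := hl' z hz
      refine ⟨y, ?_⟩
      rw [nhdsWithin, ← map_principal, ← Filter.push_pull', tendsto_map'_iff]
      refine hy.congr' ?_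
      filter_upwards [mem_inf_of_right (mem_principal_self Y)] with x hx
      simp [hc hx])
  exact ⟨Φ, hΦ, fun x hx => by simpa [hb hx] using hΦ' (mem_image_of_mem b hx)⟩

end Extension

section Limits

variable {E F : Type*} [NormedAddCommGroup E] [NormedSpace ℝ E]
  [NormedAddCommGroup F] [NormedSpace ℝ F]

theorem inv_norm_smul_inv_smul {r : ℝ} (hr : 0 < r) (v : E) :
    ‖r⁻¹ • v‖⁻¹ • (r⁻¹ • v) = ‖v‖⁻¹ • v := by
  rw [norm_smul, norm_inv, Real.norm_of_nonneg hr.le, mul_inv, inv_inv, smul_smul, mul_comm r,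
    mul_assoc, mul_inv_cancel₀ hr.ne', mul_one]

theorem leftInvOn_blowupInv (X : Set E) (p : E) :
    LeftInvOn (fun z : E × ℝ => p + z.2 • z.1) (blowupInv p) (X \ {p}) := by
  intro x hx
  have : ‖x - p‖ ≠ 0 := by simpa [sub_eq_zero] using hx.2
  simp [blowupInv, smul_smul, this]

theorem leftInvOn_blowupInvInf (X : Set E) :
    LeftInvOn (fun z : E × ℝ => z.2⁻¹ • z.1) blowupInvInf (X \ {0}) := by
  intro x hx
  have : ‖x‖ ≠ 0 := by simpa using hx.2
  simp [blowupInvInf, smul_smul, this]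

theorem neBot_comap_inf_principal {α β : Type*} [TopologicalSpace β] {b : α → β} {X : Set α} {z : β}
    (hz : z ∈ closure (b '' X)) : (comap b (𝓝 z) ⊓ 𝓟 X).NeBot := by
  rw [mem_closure_iff_nhdsWithin_neBot, nhdsWithin, ← map_principal, ← Filter.push_pull',
    map_neBot_iff] at hz
  exact hz

theorem exists_tendsto_blowupInv {h : E → F} {X : Set E} {p : E} {L : E →L[ℝ] F}
    (hX : IsClosed X) (hp : p ∈ X) (hc : ContinuousOn h X) (hi : InjOn h X)
    (hd : HasFDerivWithinAt h L X p) (hL : ∀ u, u ≠ 0 → L u ≠ 0) {z : E × ℝ}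
    (hz : z ∈ strictTransform X p) :
    ∃ y, Tendsto (fun x => blowupInv (h p) (h x)) (comap (blowupInv p) (𝓝 z) ⊓ 𝓟 (X \ {p}))
      (𝓝 y) := by
  have := neBot_comap_inf_principal hz
  set G := comap (blowupInv p) (𝓝 z) ⊓ 𝓟 (X \ {p})
  have hB : Tendsto (blowupInv p) G (𝓝 z) := tendsto_comap.mono_left inf_le_left
  have hGX : ∀ᶠ x in G, x ∈ X \ {p} := mem_inf_of_right (mem_principal_self _)
  have h1 : Tendsto (fun x => ‖x - p‖⁻¹ • (x - p)) G (𝓝 z.1) := hB.fst_nhds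
  have h2 : Tendsto (fun x => ‖x - p‖) G (𝓝 z.2) := hB.snd_nhds
  have hpos : ∀ᶠ x in G, 0 < ‖x - p‖ := by
    filter_upwards [hGX] with x hx
    simpa [sub_eq_zero] using hx.2
  have hx : Tendsto id G (𝓝 (p + z.2 • z.1)) := by
    refine (tendsto_const_nhds.add (h2.smul h1)).congr' ?_
    filter_upwards [hpos] with x hx
    simp [smul_smul, hx.ne']
  have hxX : Tendsto id G (𝓝[X] (p + z.2 • z.1)) :=
    tendsto_nhdsWithin_iff.2 ⟨hx, hGX.mono fun x hx => hx.1⟩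
  have hn : ‖z.1‖ = 1 := by
    refine tendsto_nhds_unique h1.norm (tendsto_const_nhds.congr' ?_)
    filter_upwards [hpos] with x hx
    simp [norm_smul, hx.ne']
  have hz1 : z.1 ≠ 0 := by
    rintro h0
    simp [h0] at hn
  have hRX : p + z.2 • z.1 ∈ X := hX.mem_of_tendsto hx (hGX.mono fun x hx => hx.1)
  by_cases hr : z.2 = 0
  · rw [hr, zero_smul, add_zero] at hxX
    have ho : Tendsto (fun x => ‖x - p‖⁻¹ • (h x - h p - L (x - p))) G (𝓝 0) := by
      rw [tendsto_zero_iff_norm_tendsto_zero]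
      have := (hd.isLittleO.comp_tendsto hxX).norm_norm.tendsto_div_nhds_zero
      refine this.congr fun x => ?_
      simp [norm_smul, div_eq_inv_mul]
    have hw : Tendsto (fun x => ‖x - p‖⁻¹ • (h x - h p)) G (𝓝 (L z.1)) := by
      have := ((L.continuous.tendsto z.1).comp h1).add ho
      rw [add_zero] at this
      refine this.congr fun x => ?_
      simp only [Function.comp, map_smul, ← smul_add]
      congr 1
      abel
    have hLn : ‖L z.1‖ ≠ 0 := norm_ne_zero_iff.2 (hL _ hz1)
    have hw' := (hw.norm.inv₀ hLn).smul hw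
    have hh : Tendsto (fun x => ‖h x - h p‖) G (𝓝 0) := by
      have := (((hc p hp).tendsto.comp hxX).sub_const (h p)).norm
      simpa using this
    refine ⟨(‖L z.1‖⁻¹ • L z.1, 0), Tendsto.prodMk_nhds (hw'.congr' ?_) hh⟩
    filter_upwards [hpos] with x hx
    exact inv_norm_smul_inv_smul hx _
  · set x₀ := p + z.2 • z.1
    have hne : x₀ ≠ p := by simp [x₀, hr, hz1]
    have hhx : Tendsto h G (𝓝 (h x₀)) := (hc x₀ hRX).tendsto.comp hxX
    have hne' : ‖h x₀ - h p‖ ≠ 0 := by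
      rw [norm_ne_zero_iff, sub_ne_zero]
      exact fun e => hne (hi hRX hp e)
    have hs := hhx.sub_const (h p)
    exact ⟨blowupInv (h p) (h x₀), ((hs.norm.inv₀ hne').smul hs).prodMk_nhds hs.norm⟩

theorem exists_tendsto_blowupInvInf {h : E → E} {X : Set E}
    (hX : IsClosed X) (hc : ContinuousOn h X) (h0 : ∀ x ∈ X, h x = 0 → x = 0)
    (ho : (fun x => h x - x) =o[atInftyOn X] fun x => x) {z : E × ℝ}
    (hz : z ∈ strictTransformInf X) :
    ∃ y, Tendsto (fun x => blowupInvInf (h x)) (comap blowupInvInf (𝓝 z) ⊓ 𝓟 (X \ {0}))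
      (𝓝 y) := by
  have := neBot_comap_inf_principal hz
  set G := comap blowupInvInf (𝓝 z) ⊓ 𝓟 (X \ {0})
  have hB : Tendsto blowupInvInf G (𝓝 z) := tendsto_comap.mono_left inf_le_left
  have hGX : ∀ᶠ x in G, x ∈ X \ {0} := mem_inf_of_right (mem_principal_self _)
  have h1 : Tendsto (fun x => ‖x‖⁻¹ • x) G (𝓝 z.1) := hB.fst_nhds
  have h2 : Tendsto (fun x : E => ‖x‖⁻¹) G (𝓝 z.2) := hB.snd_nhds
  have hpos : ∀ᶠ x in G, 0 < ‖x‖ := by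
    filter_upwards [hGX] with x hx
    simpa using hx.2
  have hn : ‖z.1‖ = 1 := by
    refine tendsto_nhds_unique h1.norm (tendsto_const_nhds.congr' ?_)
    filter_upwards [hpos] with x hx
    simp [norm_smul, hx.ne']
  by_cases hr : z.2 = 0
  · rw [hr] at h2
    have hat : Tendsto (fun x : E => ‖x‖) G atTop := by
      have : Tendsto (fun x : E => ‖x‖⁻¹) G (𝓝[>] 0) :=
        tendsto_nhdsWithin_iff.2 ⟨h2, hpos.mono fun x hx => inv_pos.2 hx⟩
      exact this.inv_tendsto_nhdsGT_zero.congr fun x => inv_inv _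
    have hG : G ≤ atInftyOn X := by
      refine le_inf (tendsto_iff_comap.1 hat) ?_
      rw [le_principal_iff]
      exact hGX.mono fun x hx => hx.1
    have ho' : Tendsto (fun x => ‖x‖⁻¹ • (h x - x)) G (𝓝 0) := by
      rw [tendsto_zero_iff_norm_tendsto_zero]
      refine (ho.mono hG).norm_norm.tendsto_div_nhds_zero.congr fun x => ?_
      simp [norm_smul, div_eq_inv_mul]
    have hw : Tendsto (fun x => ‖x‖⁻¹ • h x) G (𝓝 z.1) := by
      have := h1.add ho'
      rw [add_zero] at this
      refine this.congr fun x => ?_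
      rw [← smul_add]
      congr 1
      abel
    have hi := hw.norm.inv₀ (by simp [hn])
    have hinv : Tendsto (fun x => ‖h x‖⁻¹) G (𝓝 0) := by
      have := h2.mul hi
      rw [zero_mul] at this
      refine this.congr' ?_
      filter_upwards [hpos] with x hx
      rw [norm_smul, mul_inv, norm_inv, norm_norm, inv_inv, ← mul_assoc, inv_mul_cancel₀ hx.ne',
        one_mul]
    refine ⟨(‖z.1‖⁻¹ • z.1, 0), ((hi.smul hw).congr' ?_).prodMk_nhds hinv⟩
    filter_upwards [hpos] with x hx
    exact inv_norm_smul_inv_smul hx _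
  · have hx : Tendsto id G (𝓝 (z.2⁻¹ • z.1)) := by
      refine ((h2.inv₀ hr).smul h1).congr' ?_
      filter_upwards [hpos] with x hx
      simp [smul_smul, hx.ne']
    set x₀ := z.2⁻¹ • z.1
    have hRX : x₀ ∈ X := hX.mem_of_tendsto hx (hGX.mono fun x hx => hx.1)
    have hhx : Tendsto h G (𝓝 (h x₀)) :=
      (hc x₀ hRX).tendsto.comp (tendsto_nhdsWithin_iff.2 ⟨hx, hGX.mono fun x hx => hx.1⟩)
    have hne : x₀ ≠ 0 := by
      refine smul_ne_zero (inv_ne_zero hr) fun h0 => ?_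
      simp [h0] at hn
    have hne' : ‖h x₀‖ ≠ 0 := norm_ne_zero_iff.2 fun e => hne (h0 x₀ hRX e)
    exact ⟨blowupInvInf (h x₀), ((hhx.norm.inv₀ hne').smul hhx).prodMk_nhds (hhx.norm.inv₀ hne')⟩

theorem isBSHomeoAtO_some {h : E → F} {g : F → E} {X : Set E} {Y : Set F} {p : E}
    {L : E →L[ℝ] F} {M : F →L[ℝ] E} (hX : IsClosed X) (hY : IsClosed Y) (hh : MapsTo h X Y)
    (hg : MapsTo g Y X) (hgh : LeftInvOn g h X) (hhg : LeftInvOn h g Y) (hhc : ContinuousOn h X)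
    (hgc : ContinuousOn g Y) (hp : p ∈ X) (hd : HasFDerivWithinAt h L X p)
    (hd' : HasFDerivWithinAt g M Y (h p)) (hL : ∀ u, u ≠ 0 → L u ≠ 0) (hM : ∀ u, u ≠ 0 → M u ≠ 0) :
    IsBSHomeoAtO h X Y (some p) (some (h p)) := by
  refine ⟨⟨InvOn.bijOn ⟨hgh, hhg⟩ hh hg, hhc, g, hgh, hhg, hgc⟩, hhc p hp, ?_⟩
  have hgi : ∀ y ∈ Y, g y = p → y = h p := fun y hy e => by rw [← e, hhg hy]
  obtain ⟨Φ, hΦ, hΦ'⟩ := exists_isHomeoOn_closure_image (h := h) (g := g)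
    (leftInvOn_blowupInv X p) (leftInvOn_blowupInv Y (h p))
    (fun x hx => ⟨hh hx.1, fun e => hx.2 (hgh.injOn hx.1 hp e)⟩)
    (fun y hy => ⟨hg hy.1, fun e => hy.2 (hgi y hy.1 e)⟩)
    (fun x hx => hgh hx.1) (fun y hy => hhg hy.1)
    (fun z hz => exists_tendsto_blowupInv hX hp hhc hgh.injOn hd hL hz)
    (fun z hz => by
      simpa [hgh hp] using exists_tendsto_blowupInv hY (hh hp) hgc hhg.injOn hd' hM hz)
  exact ⟨Φ, hΦ, fun x hx hxp _ => hΦ' x ⟨hx, hxp⟩⟩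

theorem isBSHomeoAtO_none {h g : E → E} {X Y : Set E} (hX : IsClosed X) (hY : IsClosed Y)
    (hh : MapsTo h X Y) (hg : MapsTo g Y X) (hgh : LeftInvOn g h X) (hhg : LeftInvOn h g Y)
    (hhc : ContinuousOn h X) (hgc : ContinuousOn g Y) (h0 : h 0 = 0) (g0 : g 0 = 0)
    (ho : (fun x => h x - x) =o[atInftyOn X] fun x => x)
    (ho' : (fun x => g x - x) =o[atInftyOn Y] fun x => x) :
    IsBSHomeoAtO h X Y none none := by
  have hh0 : ∀ x ∈ X, h x = 0 → x = 0 := fun x hx e => by rw [← hgh hx, e, g0]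
  have hg0 : ∀ y ∈ Y, g y = 0 → y = 0 := fun y hy e => by rw [← hhg hy, e, h0]
  refine ⟨⟨InvOn.bijOn ⟨hgh, hhg⟩ hh hg, hhc, g, hgh, hhg, hgc⟩, ?_, ?_⟩
  · have hat : Tendsto (fun x : E => ‖x‖) (atInftyOn X) atTop :=
      tendsto_comap.mono_left inf_le_left
    refine tendsto_atTop_mono' _ ?_ (hat.atTop_div_const two_pos)
    filter_upwards [ho.def (by norm_num : (0 : ℝ) < 1 / 2)] with x hx
    have := norm_sub_norm_le x (h x)
    rw [norm_sub_rev] at this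
    linarith
  · obtain ⟨Φ, hΦ, hΦ'⟩ := exists_isHomeoOn_closure_image (h := h) (g := g)
      (leftInvOn_blowupInvInf X) (leftInvOn_blowupInvInf Y)
      (fun x hx => ⟨hh hx.1, fun e => hx.2 (hh0 x hx.1 e)⟩)
      (fun y hy => ⟨hg hy.1, fun e => hy.2 (hg0 y hy.1 e)⟩)
      (fun x hx => hgh hx.1) (fun y hy => hhg hy.1)
      (fun z hz => exists_tendsto_blowupInvInf hX hhc hh0 ho hz)
      (fun z hz => exists_tendsto_blowupInvInf hY hgc hg0 ho' hz)
    exact ⟨Φ, hΦ, fun x hx hxp _ => hΦ' x ⟨hx, hxp⟩⟩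

end Limits

section Curves

/-- The union of the curves `y = x⁴` and `y = x ^ k + x⁴` in `ℂ²`. -/
def curvePair (k : ℕ) : Set (EuclideanSpace ℂ (Fin 2)) :=
  {z | z 1 = z 0 ^ 4} ∪ {z | z 1 = z 0 ^ k + z 0 ^ 4}

/-- The shear of `ℂ²` mapping the curve `y = x ^ a + x⁴` onto the curve `y = x ^ b + x⁴`. -/
def powShear (a b : ℕ) (z : EuclideanSpace ℂ (Fin 2)) : EuclideanSpace ℂ (Fin 2) :=
  z + (z 0 ^ b - z 0 ^ a) • EuclideanSpace.single 1 1

open Classical in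
/-- The map `curvePair a → curvePair b` that is the identity on the common curve `y = x⁴` and a
shear on the other one. -/
def curvePairMap (a b : ℕ) (z : EuclideanSpace ℂ (Fin 2)) : EuclideanSpace ℂ (Fin 2) :=
  if z 1 = z 0 ^ 4 then z else powShear a b z

@[simp] theorem powShear_zero_coord (a b : ℕ) (z : EuclideanSpace ℂ (Fin 2)) :
    powShear a b z 0 = z 0 := by simp [powShear]

@[simp] theorem powShear_one_coord (a b : ℕ) (z : EuclideanSpace ℂ (Fin 2)) :
    powShear a b z 1 = z 1 + (z 0 ^ b - z 0 ^ a) := by simp [powShear]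

theorem curvePairMap_eqOn_id (a b : ℕ) : EqOn (curvePairMap a b) id {z | z 1 = z 0 ^ 4} :=
  fun _ hz => if_pos hz

theorem curvePairMap_eqOn_powShear {a b : ℕ} (ha : a ≠ 0) (hb : b ≠ 0) :
    EqOn (curvePairMap a b) (powShear a b) {z | z 1 = z 0 ^ a + z 0 ^ 4} := by
  intro z hz
  unfold curvePairMap
  split_ifs with h
  · have h0 : z 0 = 0 := by
      have : z 0 ^ a = 0 := by simpa [h] using hz
      simpa [ha] using this
    simp [powShear, h0, ha, hb]
  · rfl

theorem powShear_powShear (a b : ℕ) (z : EuclideanSpace ℂ (Fin 2)) :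
    powShear b a (powShear a b z) = z := by
  ext i
  fin_cases i
  · simp
  · simp [add_assoc]

theorem mapsTo_powShear (a b : ℕ) : MapsTo (powShear a b) {z | z 1 = z 0 ^ a + z 0 ^ 4}
    {z | z 1 = z 0 ^ b + z 0 ^ 4} := by
  intro z hz
  simp only [mem_ofPred_eq] at hz
  simp only [mem_ofPred_eq, powShear_zero_coord, powShear_one_coord, hz]
  ring

theorem mapsTo_curvePairMap {a b : ℕ} (ha : a ≠ 0) (hb : b ≠ 0) :
    MapsTo (curvePairMap a b) (curvePair a) (curvePair b) := by
  rintro z (hz | hz)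
  · rw [curvePairMap_eqOn_id a b hz]
    exact Or.inl hz
  · rw [curvePairMap_eqOn_powShear ha hb hz]
    exact Or.inr (mapsTo_powShear a b hz)

theorem leftInvOn_curvePairMap {a b : ℕ} (ha : a ≠ 0) (hb : b ≠ 0) :
    LeftInvOn (curvePairMap b a) (curvePairMap a b) (curvePair a) := by
  rintro z (hz | hz)
  · rw [curvePairMap_eqOn_id a b hz]
    exact curvePairMap_eqOn_id b a hz
  · rw [curvePairMap_eqOn_powShear ha hb hz,
      curvePairMap_eqOn_powShear hb ha (mapsTo_powShear a b hz), powShear_powShear]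

theorem isClosed_setOf_coord_eq {f : ℂ → ℂ} (hf : Continuous f) :
    IsClosed {z : EuclideanSpace ℂ (Fin 2) | z 1 = f (z 0)} :=
  isClosed_eq (by fun_prop) (by fun_prop)

theorem isClosed_curvePair (k : ℕ) : IsClosed (curvePair k) :=
  (isClosed_setOf_coord_eq (f := fun x => x ^ 4) (by fun_prop)).union
    (isClosed_setOf_coord_eq (f := fun x => x ^ k + x ^ 4) (by fun_prop))

/-- The derivative of `powShear a b` at `p`. -/
def powShearDeriv (a b : ℕ) (p : EuclideanSpace ℂ (Fin 2)) :
    EuclideanSpace ℂ (Fin 2) →L[ℂ] EuclideanSpace ℂ (Fin 2) :=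
  ContinuousLinearMap.id ℂ _ +
    (((b : ℂ) * p 0 ^ (b - 1) - a * p 0 ^ (a - 1)) • EuclideanSpace.proj (𝕜 := ℂ) 0).smulRight
      (EuclideanSpace.single 1 1)

theorem hasFDerivAt_powShear (a b : ℕ) (p : EuclideanSpace ℂ (Fin 2)) :
    HasFDerivAt (𝕜 := ℂ) (powShear a b) (powShearDeriv a b p) p := by
  have h0 : HasFDerivAt (𝕜 := ℂ) (fun z : EuclideanSpace ℂ (Fin 2) => z 0)
      (EuclideanSpace.proj (𝕜 := ℂ) 0) p := (EuclideanSpace.proj (𝕜 := ℂ) 0).hasFDerivAt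
  have h1 := ((hasDerivAt_pow b (p 0)).sub (hasDerivAt_pow a (p 0))).comp_hasFDerivAt p h0
  exact (hasFDerivAt_id p).add (h1.smul_const _)

theorem powShearDeriv_ne_zero (a b : ℕ) (p u : EuclideanSpace ℂ (Fin 2)) (hu : u ≠ 0) :
    powShearDeriv a b p u ≠ 0 := by
  contrapose! hu
  have h0 : u 0 = 0 := by simpa [powShearDeriv] using congrArg (· 0) hu
  have h1 : u 1 = 0 := by simpa [powShearDeriv, h0] using congrArg (· 1) hu
  ext i
  fin_cases i <;> simp [h0, h1]

theorem powShearDeriv_of_coord_eq_zero {a b : ℕ} (ha : 2 ≤ a) (hb : 2 ≤ b)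
    {p : EuclideanSpace ℂ (Fin 2)} (hp : p 0 = 0) :
    powShearDeriv a b p = ContinuousLinearMap.id ℂ _ := by
  ext1 u
  simp [powShearDeriv, hp, show b - 1 ≠ 0 by omega, show a - 1 ≠ 0 by omega]

theorem exists_hasFDerivWithinAt_curvePairMap {a b : ℕ} (ha : 2 ≤ a) (hb : 2 ≤ b)
    (p : EuclideanSpace ℂ (Fin 2)) :
    ∃ L : EuclideanSpace ℂ (Fin 2) →L[ℝ] EuclideanSpace ℂ (Fin 2),
      HasFDerivWithinAt (curvePairMap a b) L (curvePair a) p ∧ ∀ u, u ≠ 0 → L u ≠ 0 := by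
  have hid : p 1 = p 0 ^ 4 → HasFDerivWithinAt (𝕜 := ℂ) (curvePairMap a b)
      (ContinuousLinearMap.id ℂ _) {z | z 1 = z 0 ^ 4} p := fun hp =>
    (hasFDerivWithinAt_id p _).congr (curvePairMap_eqOn_id a b) (curvePairMap_eqOn_id a b hp)
  have hsh : p 1 = p 0 ^ a + p 0 ^ 4 → HasFDerivWithinAt (𝕜 := ℂ) (curvePairMap a b)
      (powShearDeriv a b p) {z | z 1 = z 0 ^ a + z 0 ^ 4} p := fun hp =>
    (hasFDerivAt_powShear a b p).hasFDerivWithinAt.congr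
      (curvePairMap_eqOn_powShear (by omega) (by omega))
      (curvePairMap_eqOn_powShear (by omega) (by omega) hp)
  have hid' : p 1 ≠ p 0 ^ 4 → ∀ L, HasFDerivWithinAt (𝕜 := ℂ) (curvePairMap a b)
      L {z | z 1 = z 0 ^ 4} p := fun hp L =>
    HasFDerivWithinAt.of_notMem_closure
      (by rwa [(isClosed_setOf_coord_eq (f := fun x => x ^ 4) (by fun_prop)).closure_eq])
  have hsh' : p 1 ≠ p 0 ^ a + p 0 ^ 4 → ∀ L, HasFDerivWithinAt (𝕜 := ℂ) (curvePairMap a b)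
      L {z | z 1 = z 0 ^ a + z 0 ^ 4} p := fun hp L =>
    HasFDerivWithinAt.of_notMem_closure
      (by rwa [(isClosed_setOf_coord_eq (f := fun x => x ^ a + x ^ 4) (by fun_prop)).closure_eq])
  suffices ∃ L : EuclideanSpace ℂ (Fin 2) →L[ℂ] EuclideanSpace ℂ (Fin 2),
      HasFDerivWithinAt (curvePairMap a b) L (curvePair a) p ∧ ∀ u, u ≠ 0 → L u ≠ 0 by
    obtain ⟨L, hL, hL'⟩ := this
    exact ⟨L.restrictScalars ℝ, hL.restrictScalars ℝ, hL'⟩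
  by_cases h2 : p 1 = p 0 ^ a + p 0 ^ 4
  · refine ⟨powShearDeriv a b p, HasFDerivWithinAt.union ?_ (hsh h2), powShearDeriv_ne_zero a b p⟩
    by_cases h1 : p 1 = p 0 ^ 4
    · have h0 : p 0 = 0 := by
        have : p 0 ^ a = 0 := by simpa [h1] using h2
        exact pow_eq_zero_iff (by omega) |>.1 this
      rw [powShearDeriv_of_coord_eq_zero ha hb h0]
      exact hid h1
    · exact hid' h1 _
  · refine ⟨ContinuousLinearMap.id ℂ _, HasFDerivWithinAt.union ?_ (hsh' h2 _), fun u hu => hu⟩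
    by_cases h1 : p 1 = p 0 ^ 4
    · exact hid h1
    · exact hid' h1 _

theorem norm_le_coord_add_coord (z : EuclideanSpace ℂ (Fin 2)) : ‖z‖ ≤ ‖z 0‖ + ‖z 1‖ := by
  rw [EuclideanSpace.norm_eq, Fin.sum_univ_two]
  refine Real.sqrt_le_iff.2 ⟨by positivity, ?_⟩
  nlinarith [norm_nonneg (z 0), norm_nonneg (z 1)]

theorem pow_le_one_add_pow_three {t : ℝ} (ht : 0 ≤ t) {k : ℕ} (hk : k ≤ 3) : t ^ k ≤ 1 + t ^ 3 := by
  rcases le_total t 1 with h | h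
  · linarith [pow_le_one₀ (n := k) ht h, pow_nonneg ht 3]
  · linarith [pow_le_pow_right₀ h hk]

theorem isLittleO_curvePairMap_sub {a b : ℕ} (ha : a ≠ 0) (hb : b ≠ 0) (ha' : a ≤ 3) (hb' : b ≤ 3) :
    (fun z => curvePairMap a b z - z) =o[atInftyOn (curvePair a)] fun z => z := by
  rw [Asymptotics.isLittleO_iff]
  intro c hc
  set T : ℝ := 8 + 8 / c
  have hT : 0 ≤ 8 / c := by positivity
  have hat : Tendsto (fun x : EuclideanSpace ℂ (Fin 2) => ‖x‖) (atInftyOn (curvePair a)) atTop :=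
    tendsto_comap.mono_left inf_le_left
  filter_upwards [hat.eventually_gt_atTop (T + (1 + T ^ 3) + T ^ 4),
    mem_inf_of_right (mem_principal_self _)] with z hz hzX
  rcases hzX with h | h
  · rw [curvePairMap_eqOn_id a b h]
    simp only [id, sub_self, norm_zero]
    positivity
  · rw [curvePairMap_eqOn_powShear ha hb h]
    simp only [mem_ofPred_eq] at h
    set t := ‖z 0‖
    have ht : 0 ≤ t := norm_nonneg _
    have hka := pow_le_one_add_pow_three ht ha'
    have hkb := pow_le_one_add_pow_three ht hb'
    have hd : ‖powShear a b z - z‖ ≤ 2 * (1 + t ^ 3) := by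
      have : powShear a b z - z = (z 0 ^ b - z 0 ^ a) • EuclideanSpace.single 1 1 := by
        simp [powShear]
      rw [this, norm_smul]
      have := norm_sub_le (z 0 ^ b) (z 0 ^ a)
      simp only [norm_pow, PiLp.norm_single, norm_one, mul_one] at this ⊢
      linarith
    have hz1 : ‖z 1‖ ≤ (1 + t ^ 3) + t ^ 4 := by
      have := norm_add_le (z 0 ^ a) (z 0 ^ 4)
      rw [← h, norm_pow, norm_pow] at this
      linarith
    have htT : T ≤ t := by
      by_contra! hlt
      have := norm_le_coord_add_coord z
      have h3 : t ^ 3 ≤ T ^ 3 := by gcongr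
      have h4 : t ^ 4 ≤ T ^ 4 := by gcongr
      linarith
    have hlow : t ^ 4 - (1 + t ^ 3) ≤ ‖z‖ := by
      have h1 : ‖z 1‖ ≤ ‖z‖ := PiLp.norm_apply_le z 1
      have h2 := norm_sub_norm_le (z 0 ^ 4) (-z 0 ^ a)
      have h3 : z 0 ^ 4 - -z 0 ^ a = z 1 := by rw [h]; ring
      rw [h3, norm_neg, norm_pow, norm_pow] at h2
      linarith
    have ht8 : 8 ≤ t := by linarith
    have hct : 8 ≤ c * t := by
      have : 8 / c ≤ t := by linarith
      rw [div_le_iff₀ hc] at this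
      linarith
    have h1 : 1 ≤ t ^ 3 := one_le_pow₀ (by linarith)
    have h4 : t ^ 4 / 2 ≤ ‖z‖ := by nlinarith
    calc ‖powShear a b z - z‖ ≤ 4 * t ^ 3 := by linarith
      _ ≤ c * (t ^ 4 / 2) := by nlinarith
      _ ≤ c * ‖z‖ := by gcongr

theorem isBSHomeo_curvePairMap {a b : ℕ} (ha : 2 ≤ a) (hb : 2 ≤ b) (ha' : a ≤ 3) (hb' : b ≤ 3) :
    IsBSHomeo (curvePairMap a b) (curvePair a) (curvePair b) := by
  have hX := isClosed_curvePair a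
  have hY := isClosed_curvePair b
  have hh : MapsTo (curvePairMap a b) _ _ := mapsTo_curvePairMap (by omega) (by omega)
  have hg : MapsTo (curvePairMap b a) _ _ := mapsTo_curvePairMap (by omega) (by omega)
  have hgh : LeftInvOn _ (curvePairMap a b) _ := leftInvOn_curvePairMap (by omega) (by omega)
  have hhg : LeftInvOn _ (curvePairMap b a) _ := leftInvOn_curvePairMap (by omega) (by omega)
  have hcont : ∀ {a b : ℕ}, 2 ≤ a → 2 ≤ b → ContinuousOn (curvePairMap a b) (curvePair a) := by
    intro a b ha hb p _
    obtain ⟨L, hL, _⟩ := exists_hasFDerivWithinAt_curvePairMap ha hb p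
    exact hL.continuousWithinAt
  have hzero : ∀ a b, curvePairMap a b 0 = 0 := fun a b => if_pos (by simp)
  refine ⟨⟨InvOn.bijOn ⟨hgh, hhg⟩ hh hg, hcont ha hb, _, hgh, hhg, hcont hb ha⟩, ?_, none, ?_⟩
  · intro p hp
    rw [hX.closure_eq] at hp
    obtain ⟨L, hL, hL'⟩ := exists_hasFDerivWithinAt_curvePairMap ha hb p
    obtain ⟨M, hM, hM'⟩ := exists_hasFDerivWithinAt_curvePairMap hb ha (curvePairMap a b p)
    exact ⟨_, isBSHomeoAtO_some hX hY hh hg hgh hhg (hcont ha hb) (hcont hb ha) hp hL hM hL' hM'⟩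
  · exact isBSHomeoAtO_none hX hY hh hg hgh hhg (hcont ha hb) (hcont hb ha) (hzero a b) (hzero b a)
      (isLittleO_curvePairMap_sub (by omega) (by omega) ha' hb')
      (isLittleO_curvePairMap_sub (by omega) (by omega) hb' ha')

end Curves

section Connectedness

theorem isPreconnected_graph_diff_singleton {f : ℂ → ℂ} (hf : Continuous f)
    (p : EuclideanSpace ℂ (Fin 2)) :
    IsPreconnected ({z : EuclideanSpace ℂ (Fin 2) | z 1 = f (z 0)} \ {p}) := by
  have hγ : Continuous fun x : ℂ => !₂[x, f x] := by fun_prop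
  have hmem : ∀ z : EuclideanSpace ℂ (Fin 2), z 1 = f (z 0) → !₂[z 0, f (z 0)] = z := by
    intro z hz
    ext i
    fin_cases i <;> simp [hz]
  have hconn : ∀ q : ℂ, IsPreconnected ({q}ᶜ : Set ℂ) := fun q =>
    (isConnected_compl_singleton_of_one_lt_rank (by simp [Complex.rank_real_complex]) q).isPreconnected
  by_cases hp : p 1 = f (p 0)
  · convert (hconn (p 0)).image _ hγ.continuousOn using 1
    ext z
    constructor
    · rintro ⟨hz, hzp⟩
      refine ⟨z 0, fun h0 => hzp ?_, hmem z hz⟩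
      have h0' : z 0 = p 0 := h0
      rw [mem_singleton_iff, ← hmem z hz, ← hmem p hp, h0']
    · rintro ⟨x, hx, rfl⟩
      refine ⟨by simp, fun h => hx ?_⟩
      simpa using congrArg (· 0) h
  · have : {z : EuclideanSpace ℂ (Fin 2) | z 1 = f (z 0)} \ {p} = (fun x => !₂[x, f x]) '' univ := by
      ext z
      constructor
      · rintro ⟨hz, -⟩
        exact ⟨z 0, mem_univ _, hmem z hz⟩
      · rintro ⟨x, -, rfl⟩
        refine ⟨by simp, fun h => hp ?_⟩
        rw [← mem_singleton_iff.1 h]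
        simp
    rw [this]
    exact isPreconnected_univ.image _ hγ.continuousOn

theorem isPreconnected_curvePair_diff_singleton {k : ℕ} (hk : k ≠ 0)
    {p : EuclideanSpace ℂ (Fin 2)} (hp : p ≠ 0) : IsPreconnected (curvePair k \ {p}) := by
  rw [curvePair, union_sdiff_distrib]
  exact IsPreconnected.union 0 ⟨by simp, hp.symm⟩ ⟨by simp [hk], hp.symm⟩
    (isPreconnected_graph_diff_singleton (f := fun x => x ^ 4) (by fun_prop) p)
    (isPreconnected_graph_diff_singleton (f := fun x => x ^ k + x ^ 4) (by fun_prop) p)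

theorem subset_or_subset_of_isPreconnected {k : ℕ} (hk : k ≠ 0)
    {S : Set (EuclideanSpace ℂ (Fin 2))} (hS : IsPreconnected S) (hSk : S ⊆ curvePair k \ {0}) :
    S ⊆ {z | z 1 = z 0 ^ 4} ∨ S ⊆ {z | z 1 = z 0 ^ k + z 0 ^ 4} := by
  by_contra! hcon
  obtain ⟨⟨z, hz, hz1⟩, ⟨w, hw, hw1⟩⟩ := And.intro (not_subset.1 hcon.1) (not_subset.1 hcon.2)
  obtain ⟨v, hv, hv1, hv2⟩ := isPreconnected_closed_iff.1 hS _ _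
    (isClosed_setOf_coord_eq (f := fun x => x ^ 4) (by fun_prop))
    (isClosed_setOf_coord_eq (f := fun x => x ^ k + x ^ 4) (by fun_prop))
    (fun x hx => (hSk hx).1) ⟨w, hw, (hSk hw).1.resolve_right hw1⟩
    ⟨z, hz, (hSk hz).1.resolve_left hz1⟩
  simp only [mem_ofPred_eq] at hv1 hv2
  have h0 : v 0 = 0 := by
    have : v 0 ^ k = 0 := by simpa [hv1] using hv2
    simpa [hk] using this
  refine (hSk hv).2 ?_
  rw [mem_singleton_iff]
  ext i
  fin_cases i <;> simp [h0, hv1]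

theorem exists_mem_curvePair_notMem_left (k : ℕ) :
    ∃ z ∈ curvePair k \ {0}, z ∉ {z | z 1 = z 0 ^ 4} := by
  refine ⟨!₂[1, 2], ⟨Or.inr (by simp; norm_num), fun h => ?_⟩, by simp⟩
  simpa using congrArg (· 0) h

theorem exists_mem_curvePair_notMem_right (k : ℕ) :
    ∃ z ∈ curvePair k \ {0}, z ∉ {z | z 1 = z 0 ^ k + z 0 ^ 4} := by
  refine ⟨!₂[1, 1], ⟨Or.inl (by simp), fun h => ?_⟩, by simp⟩
  simpa using congrArg (· 0) h

theorem map_zero_of_bijOn_curvePair {a b : ℕ} (ha : a ≠ 0) (hb : b ≠ 0)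
    {g : EuclideanSpace ℂ (Fin 2) → EuclideanSpace ℂ (Fin 2)}
    (hg : BijOn g (curvePair a) (curvePair b)) (hc : ContinuousOn g (curvePair a)) : g 0 = 0 := by
  obtain ⟨s, hs, hs0⟩ := hg.surjOn (show (0 : EuclideanSpace ℂ (Fin 2)) ∈ curvePair b by
    simp [curvePair])
  by_cases hs' : s = 0
  · rwa [hs'] at hs0
  have himg : curvePair b \ {0} ⊆ g '' (curvePair a \ {s}) := by
    rintro y ⟨hy, hy0⟩
    obtain ⟨x, hx, rfl⟩ := hg.surjOn hy
    exact ⟨x, ⟨hx, fun h => hy0 (by rw [mem_singleton_iff.1 h, hs0]; rfl)⟩, rfl⟩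
  rcases subset_or_subset_of_isPreconnected hb
    ((isPreconnected_curvePair_diff_singleton ha hs').image g (hc.mono sdiff_subset))
    (by
      rintro _ ⟨x, ⟨hx, hxs⟩, rfl⟩
      exact ⟨hg.mapsTo hx, fun h => hxs (hg.injOn hx hs (by rw [hs0, mem_singleton_iff.1 h]))⟩)
    with h | h
  · obtain ⟨z, hz, hzn⟩ := exists_mem_curvePair_notMem_left b
    exact absurd (h (himg hz)) hzn
  · obtain ⟨z, hz, hzn⟩ := exists_mem_curvePair_notMem_right b
    exact absurd (h (himg hz)) hzn

/-- A homeomorphism between curve pairs maps each branch minus the origin into a branch, and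
distinct branches into distinct branches. -/
theorem mapsTo_branches_of_bijOn_curvePair {a b : ℕ} (ha : a ≠ 0) (hb : b ≠ 0)
    {g : EuclideanSpace ℂ (Fin 2) → EuclideanSpace ℂ (Fin 2)}
    (hg : BijOn g (curvePair a) (curvePair b)) (hc : ContinuousOn g (curvePair a)) :
    (MapsTo g ({z | z 1 = z 0 ^ 4} \ {0}) {z | z 1 = z 0 ^ 4} ∧
      MapsTo g ({z | z 1 = z 0 ^ a + z 0 ^ 4} \ {0}) {z | z 1 = z 0 ^ b + z 0 ^ 4}) ∨
    (MapsTo g ({z | z 1 = z 0 ^ 4} \ {0}) {z | z 1 = z 0 ^ b + z 0 ^ 4} ∧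
      MapsTo g ({z | z 1 = z 0 ^ a + z 0 ^ 4} \ {0}) {z | z 1 = z 0 ^ 4}) := by
  have g0 := map_zero_of_bijOn_curvePair ha hb hg hc
  have h0 : (0 : EuclideanSpace ℂ (Fin 2)) ∈ curvePair a := Or.inl (by simp)
  have hbr : ∀ f : ℂ → ℂ, Continuous f →
      {z : EuclideanSpace ℂ (Fin 2) | z 1 = f (z 0)} ⊆ curvePair a →
      MapsTo g ({z | z 1 = f (z 0)} \ {0}) {z | z 1 = z 0 ^ 4} ∨
      MapsTo g ({z | z 1 = f (z 0)} \ {0}) {z | z 1 = z 0 ^ b + z 0 ^ 4} := by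
    intro f hf hfa
    simp only [mapsTo_iff_image_subset]
    refine subset_or_subset_of_isPreconnected hb ((isPreconnected_graph_diff_singleton hf 0).image g
      (hc.mono (sdiff_subset.trans hfa))) ?_
    rintro _ ⟨x, ⟨hx, hx0⟩, rfl⟩
    exact ⟨hg.mapsTo (hfa hx), fun h => hx0 (hg.injOn (hfa hx) h0 (by rw [g0]; exact h))⟩
  have hboth : ∀ D : Set (EuclideanSpace ℂ (Fin 2)),
      MapsTo g ({z | z 1 = z 0 ^ 4} \ {0}) D → MapsTo g ({z | z 1 = z 0 ^ a + z 0 ^ 4} \ {0}) D →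
      curvePair b \ {0} ⊆ D := by
    rintro D h1 h2 y ⟨hy, hy0⟩
    obtain ⟨x, hx, rfl⟩ := hg.surjOn hy
    have hx0 : x ∉ ({0} : Set (EuclideanSpace ℂ (Fin 2))) := by
      rintro rfl
      exact hy0 g0
    rcases hx with hx | hx
    exacts [h1 ⟨hx, hx0⟩, h2 ⟨hx, hx0⟩]
  rcases hbr (fun x => x ^ 4) (by fun_prop) subset_union_left with h1 | h1 <;>
    rcases hbr (fun x => x ^ a + x ^ 4) (by fun_prop) subset_union_right with h2 | h2
  · obtain ⟨z, hz, hz'⟩ := exists_mem_curvePair_notMem_left b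
    exact absurd (hboth _ h1 h2 hz) hz'
  · exact Or.inl ⟨h1, h2⟩
  · exact Or.inr ⟨h1, h2⟩
  · obtain ⟨z, hz, hz'⟩ := exists_mem_curvePair_notMem_right b
    exact absurd (hboth _ h1 h2 hz) hz'

end Connectedness

section Lipschitz

theorem OuterLipeo.symm {E F : Type*} [NormedAddCommGroup E] [NormedAddCommGroup F]
    {X : Set E} {Y : Set F} (h : OuterLipeo X Y) : OuterLipeo Y X := by
  obtain ⟨f, lam, hlam, hf, hb⟩ := h
  have : Nonempty E := ⟨0⟩
  have hl0 : 0 < lam := by linarith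
  have hinv := hf.invOn_invFunOn
  have hm : MapsTo (Function.invFunOn f X) Y X := hf.surjOn.mapsTo_invFunOn
  refine ⟨Function.invFunOn f X, lam, hlam, BijOn.mk hm hinv.2.injOn
    (fun x hx => ⟨f x, hf.mapsTo hx, hinv.1 hx⟩), fun y hy y' hy' => ?_⟩
  have := hb _ (hm hy) _ (hm hy')
  rw [hinv.2 hy, hinv.2 hy'] at this
  exact ⟨(inv_mul_le_iff₀ hl0).2 this.2, (inv_mul_le_iff₀ hl0).1 this.1⟩

/-- The curves `y = x⁴` and `y = x² + x⁴` have contact of order two at the origin. -/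
theorem sq_norm_le_of_mem_branches {z w : EuclideanSpace ℂ (Fin 2)} (hz : z 1 = z 0 ^ 4)
    (hw : w 1 = w 0 ^ 2 + w 0 ^ 4) (hz1 : ‖z‖ ≤ 1) (hw1 : ‖w‖ ≤ 1) :
    ‖w‖ ^ 2 ≤ 45 * ‖z - w‖ := by
  have hx : ‖z 0‖ ≤ 1 := (PiLp.norm_apply_le z 0).trans hz1
  have hs : ‖w 0‖ ≤ 1 := (PiLp.norm_apply_le w 0).trans hw1
  have h0 : ‖z 0 - w 0‖ ≤ ‖z - w‖ := PiLp.norm_apply_le (z - w) 0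
  have h1 : ‖z 1 - w 1‖ ≤ ‖z - w‖ := PiLp.norm_apply_le (z - w) 1
  have h4 : ‖z 0 ^ 4 - w 0 ^ 4‖ ≤ 4 * ‖z - w‖ := by
    have he : z 0 ^ 4 - w 0 ^ 4 = (z 0 - w 0) *
        (z 0 ^ 3 + z 0 ^ 2 * w 0 + z 0 * w 0 ^ 2 + w 0 ^ 3) := by ring
    have hb : ‖z 0 ^ 3 + z 0 ^ 2 * w 0 + z 0 * w 0 ^ 2 + w 0 ^ 3‖ ≤ 1 + 1 + 1 + 1 := by
      refine norm_add_le_of_le (norm_add_le_of_le (norm_add_le_of_le ?_ ?_) ?_) ?_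
      · rw [norm_pow]; exact pow_le_one₀ (norm_nonneg _) hx
      · rw [norm_mul, norm_pow]
        exact mul_le_one₀ (pow_le_one₀ (norm_nonneg _) hx) (norm_nonneg _) hs
      · rw [norm_mul, norm_pow]
        exact mul_le_one₀ hx (by positivity) (pow_le_one₀ (norm_nonneg _) hs)
      · rw [norm_pow]; exact pow_le_one₀ (norm_nonneg _) hs
    rw [he, norm_mul]
    nlinarith [norm_nonneg (z 0 - w 0), norm_nonneg (z - w)]
  have h2 : ‖w 0‖ ^ 2 ≤ 5 * ‖z - w‖ := by
    have he : w 0 ^ 2 = (z 0 ^ 4 - w 0 ^ 4) - (z 1 - w 1) := by rw [hz, hw]; ring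
    rw [← norm_pow, he]
    linarith [norm_sub_le (z 0 ^ 4 - w 0 ^ 4) (z 1 - w 1)]
  have h3 : ‖w‖ ≤ 3 * ‖w 0‖ := by
    have ha := norm_le_coord_add_coord w
    have hb := norm_add_le (w 0 ^ 2) (w 0 ^ 4)
    rw [← hw, norm_pow, norm_pow] at hb
    have hc : ‖w 0‖ ^ 2 ≤ ‖w 0‖ := pow_le_of_le_one (norm_nonneg _) hs two_ne_zero
    have hd : ‖w 0‖ ^ 4 ≤ ‖w 0‖ := pow_le_of_le_one (norm_nonneg _) hs four_ne_zero
    linarith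
  nlinarith [norm_nonneg w, norm_nonneg (w 0)]

theorem not_outerLipeo_curvePair_three_two : ¬ OuterLipeo (curvePair 3) (curvePair 2) := by
  rintro ⟨g, lam, hlam, hg, hb⟩
  have hl0 : 0 < lam := by linarith
  have hc : ContinuousOn g (curvePair 3) := by
    refine (LipschitzOnWith.of_dist_le_mul (K := lam.toNNReal) fun x hx y hy => ?_).continuousOn
    rw [dist_eq_norm, dist_eq_norm, Real.coe_toNNReal _ hl0.le]
    exact (hb x hx y hy).2
  have g0 := map_zero_of_bijOn_curvePair three_ne_zero two_ne_zero hg hc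
  have h0 : (0 : EuclideanSpace ℂ (Fin 2)) ∈ curvePair 3 := Or.inl (by simp)
  set t : ℝ := 1 / (100 * lam ^ 3)
  have ht0 : 0 < t := by positivity
  have hl3 : lam ^ 3 * t = 1 / 100 := by simp only [t]; field_simp
  have hlt : lam * t ≤ 1 / 100 := by
    rw [← hl3]
    gcongr
    nlinarith [mul_pos hl0 hl0, mul_le_mul hlam hlam zero_le_one hl0.le]
  have ht1 : t ≤ 1 / 100 := by nlinarith
  have h3 : t ^ 3 ≤ t := pow_le_of_le_one ht0.le (by linarith) three_ne_zero
  have h4 : t ^ 4 ≤ t := pow_le_of_le_one ht0.le (by linarith) four_ne_zero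
  have hnt : ‖(t : ℂ)‖ = t := by simp [ht0.le]
  have hpt : ∀ y : ℂ, ‖y‖ ≤ 2 * t → !₂[(t : ℂ), y] ∈ curvePair 3 →
      !₂[(t : ℂ), y] ≠ 0 ∧ ‖g !₂[(t : ℂ), y]‖ ≤ 1 ∧ lam⁻¹ * t ≤ ‖g !₂[(t : ℂ), y]‖ := by
    intro y hy hmem
    have h1 : t ≤ ‖!₂[(t : ℂ), y]‖ := by
      have := PiLp.norm_apply_le !₂[(t : ℂ), y] 0
      simpa [abs_of_pos ht0] using this
    have h2 : ‖!₂[(t : ℂ), y]‖ ≤ 3 * t := by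
      have := norm_le_coord_add_coord !₂[(t : ℂ), y]
      simp only [Matrix.cons_val_zero, Matrix.cons_val_one, hnt] at this
      linarith
    have h := hb _ hmem 0 h0
    rw [g0, sub_zero, sub_zero] at h
    refine ⟨fun e => ?_, ?_, ?_⟩
    · rw [e, norm_zero] at h1
      linarith
    · nlinarith [h.2]
    · refine le_trans ?_ h.1
      gcongr
  have hA : !₂[(t : ℂ), (t : ℂ) ^ 4] ∈ {z : EuclideanSpace ℂ (Fin 2) | z 1 = z 0 ^ 4} := by simp
  have hB : !₂[(t : ℂ), (t : ℂ) ^ 3 + (t : ℂ) ^ 4] ∈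
      {z : EuclideanSpace ℂ (Fin 2) | z 1 = z 0 ^ 3 + z 0 ^ 4} := by simp
  set A := !₂[(t : ℂ), (t : ℂ) ^ 4]
  set B := !₂[(t : ℂ), (t : ℂ) ^ 3 + (t : ℂ) ^ 4]
  obtain ⟨hA0, hA1, hA2⟩ := hpt ((t : ℂ) ^ 4) (by rw [norm_pow, hnt]; linarith) (Or.inl hA)
  obtain ⟨hB0, hB1, hB2⟩ := hpt ((t : ℂ) ^ 3 + (t : ℂ) ^ 4)
    (by
      have := norm_add_le ((t : ℂ) ^ 3) ((t : ℂ) ^ 4)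
      rw [norm_pow, norm_pow, hnt] at this
      linarith) (Or.inr hB)
  have hAB : ‖A - B‖ = t ^ 3 := by
    have : A - B = EuclideanSpace.single 1 (-(t : ℂ) ^ 3) := by
      ext i
      fin_cases i <;> simp [A, B]
    rw [this, PiLp.norm_single, norm_neg, norm_pow, hnt]
  have hd : ‖g A - g B‖ ≤ lam * t ^ 3 := hAB ▸ (hb A (Or.inl hA) B (Or.inr hB)).2
  have key : ∀ w : EuclideanSpace ℂ (Fin 2), lam⁻¹ * t ≤ ‖w‖ → ¬ ‖w‖ ^ 2 ≤ 45 * ‖g A - g B‖ := by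
    intro w hw hw'
    have h1 : (lam⁻¹ * t) ^ 2 ≤ 45 * (lam * t ^ 3) :=
      (pow_le_pow_left₀ (by positivity) hw 2).trans (by linarith)
    have h2 : t ^ 2 ≤ 45 * (lam ^ 3 * t) * t ^ 2 := by
      calc t ^ 2 = lam ^ 2 * (lam⁻¹ * t) ^ 2 := by field_simp
        _ ≤ lam ^ 2 * (45 * (lam * t ^ 3)) := by gcongr
        _ = _ := by ring
    rw [hl3] at h2
    nlinarith [pow_pos ht0 2]
  rcases mapsTo_branches_of_bijOn_curvePair three_ne_zero two_ne_zero hg hc with ⟨h1, h2⟩ | ⟨h1, h2⟩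
  · exact key _ hB2 (sq_norm_le_of_mem_branches (h1 ⟨hA, hA0⟩) (h2 ⟨hB, hB0⟩) hA1 hB1)
  · refine key _ hA2 ?_
    rw [norm_sub_rev]
    exact sq_norm_le_of_mem_branches (h2 ⟨hB, hB0⟩) (h1 ⟨hA, hA0⟩) hB1 hA1

end Lipschitz

/-- `C = C₁ ∪ C₂` and `C̃ = C₁ ∪ C₃` are blow-spherical homeomorphic but not
outer lipeomorphic, where `C₁ : y = x⁴`, `C₂ : y = x² + x⁴` and `C₃ : y = x³ + x⁴`. -/
theorem bs_homeo_but_not_outer_lipeo :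
    (∃ h : EuclideanSpace ℂ (Fin 2) → EuclideanSpace ℂ (Fin 2),
      IsBSHomeo h
        ({z : EuclideanSpace ℂ (Fin 2) | z 1 = z 0 ^ 4} ∪
          {z : EuclideanSpace ℂ (Fin 2) | z 1 = z 0 ^ 2 + z 0 ^ 4})
        ({z : EuclideanSpace ℂ (Fin 2) | z 1 = z 0 ^ 4} ∪
          {z : EuclideanSpace ℂ (Fin 2) | z 1 = z 0 ^ 3 + z 0 ^ 4})) ∧
    ¬ OuterLipeo
        ({z : EuclideanSpace ℂ (Fin 2) | z 1 = z 0 ^ 4} ∪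
          {z : EuclideanSpace ℂ (Fin 2) | z 1 = z 0 ^ 2 + z 0 ^ 4})
        ({z : EuclideanSpace ℂ (Fin 2) | z 1 = z 0 ^ 4} ∪
          {z : EuclideanSpace ℂ (Fin 2) | z 1 = z 0 ^ 3 + z 0 ^ 4}) :=
  ⟨⟨curvePairMap 2 3, isBSHomeo_curvePairMap le_rfl (by norm_num) (by norm_num) le_rfl⟩,
    fun h => not_outerLipeo_curvePair_three_two h.symm⟩

end
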